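/- Let S be the unilateral shift on ℓ²(ℤ₊) and C*(S) the closed star-subalgebra of bounded operators generated by S. Then the compact operators K(ℓ²(ℤ₊)) are contained in C*(S), and there exists a surjective star-algebra homomorphism β : C*(S) → C(𝕋, ℂ) (continuous functions on the unit circle) whose kernel is exactly K(ℓ²(ℤ₊)) and which sends S* to the coordinate function z (the inclusion 𝕋 ↪ ℂ). In particular the quotient C*(S)/K(ℓ²(ℤ₊)) is star-isomorphic to C(𝕋). -/

import Mathlib

noncomputable section

/-- `ℓ²(ℤ₊)`: the Hilbert space of square-summable complex sequences indexed by `ℕ`. -/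
abbrev LTwo : Type := lp (fun _ : ℕ => ℂ) 2

/-- The standard orthonormal basis of `ℓ²(ℤ₊)`. -/
def stdBasis (n : ℕ) : LTwo := lp.single 2 n 1

/-- The coordinate function on the unit circle. -/
def circleCoord : C(Circle, ℂ) := ⟨fun t : Circle => (t : ℂ), continuous_subtype_val⟩

@[simp]
lemma circleCoord_apply (t : Circle) : circleCoord t = (t : ℂ) := rfl

lemma circleCoord_mul_star : circleCoord * star circleCoord = 1 := by
  ext t
  simp [Complex.mul_conj]

lemma star_circleCoord_mul : star circleCoord * circleCoord = 1 := by
  rw [mul_comm, circleCoord_mul_star]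

/-- The Laurent monomials in the coordinate function span a dense subspace of `C(𝕋, ℂ)`. -/
lemma mem_of_circleCoord_pow_mem (M : Submodule ℂ C(Circle, ℂ))
    (hM : IsClosed (M : Set C(Circle, ℂ)))
    (h : ∀ m n : ℕ, circleCoord ^ m * star circleCoord ^ n ∈ M) (f : C(Circle, ℂ)) : f ∈ M := by
  have hsep : (StarAlgebra.adjoin ℂ {circleCoord}).SeparatesPoints := by
    intro s t hst
    exact ⟨_, ⟨circleCoord, StarAlgebra.self_mem_adjoin_singleton ℂ _, rfl⟩,
      fun h => hst (Subtype.ext h)⟩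
  have hf : f ∈ (StarAlgebra.adjoin ℂ {circleCoord}).topologicalClosure := by
    rw [ContinuousMap.starSubalgebra_topologicalClosure_eq_top_of_separatesPoints _ hsep]
    trivial
  refine closure_minimal (fun g hg => ?_) hM hf
  rw [SetLike.mem_coe, ← StarSubalgebra.mem_toSubalgebra, StarAlgebra.adjoin_toSubalgebra,
    ← Subalgebra.mem_toSubmodule, Algebra.adjoin_eq_span] at hg
  refine Submodule.span_le.mpr ?_ hg
  intro x hx
  rw [Set.star_singleton, Set.singleton_union, SetLike.mem_coe, Submonoid.mem_closure_pair] at hx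
  obtain ⟨m, n, rfl⟩ := hx
  exact h m n

/-- Continuous functional calculus of a unitary, seen as a representation of `C(𝕋, ℂ)`. -/
lemma exists_starAlgHom_circleCoord {A : Type*} [CStarAlgebra A] (W : unitary A) :
    ∃ Φ : C(Circle, ℂ) →⋆ₐ[ℂ] A, Continuous Φ ∧ Φ circleCoord = W := by
  have hn : IsStarNormal (W : A) := inferInstance
  let r : C(spectrum ℂ (W : A), Circle) :=
    ⟨fun x => ⟨x, by
      simpa [Submonoid.unitSphere] using Unitary.spectrum_subset_circle W x.2⟩, by fun_prop⟩
  refine ⟨(cfcHom hn).comp (r.compStarAlgHom' ℂ ℂ),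
    (cfcHom_continuous hn).comp (ContinuousMap.continuous_precomp r), ?_⟩
  exact cfcHom_id hn

/-- The standard basis as a Hilbert basis. -/
def stdHilbertBasis : HilbertBasis ℕ ℂ LTwo := ⟨LinearIsometryEquiv.refl ℂ LTwo⟩

lemma coe_stdHilbertBasis : ⇑stdHilbertBasis = stdBasis := by
  ext1 n
  rw [← stdHilbertBasis.repr_symm_single n]
  rfl

lemma orthonormal_stdBasis : Orthonormal ℂ stdBasis :=
  coe_stdHilbertBasis ▸ stdHilbertBasis.orthonormal

lemma dense_span_stdBasis : (Submodule.span ℂ (Set.range stdBasis)).topologicalClosure = ⊤ :=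
  coe_stdHilbertBasis ▸ stdHilbertBasis.dense_span

lemma clm_ext_stdBasis {E : Type*} [NormedAddCommGroup E] [NormedSpace ℂ E] {A B : LTwo →L[ℂ] E}
    (h : ∀ n, A (stdBasis n) = B (stdBasis n)) : A = B := by
  refine ContinuousLinearMap.ext_on
    (Submodule.dense_iff_topologicalClosure_eq_top.mpr dense_span_stdBasis) ?_
  rintro _ ⟨n, rfl⟩
  exact h n

/-- The unilateral shift has a unitary dilation. -/
lemma exists_unitary_dilation (S : LTwo →L[ℂ] LTwo)
    (hS : ∀ n : ℕ, S (stdBasis n) = stdBasis (n + 1)) :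
    ∃ (W : unitary (lp (fun _ : ℤ => ℂ) 2 →L[ℂ] lp (fun _ : ℤ => ℂ) 2))
      (V : LTwo →L[ℂ] lp (fun _ : ℤ => ℂ) 2),
      ContinuousLinearMap.adjoint V ∘L V = 1 ∧ (star W).1 ∘L V = V ∘L S := by
  let b : HilbertBasis ℤ ℂ (lp (fun _ : ℤ => ℂ) 2) := ⟨LinearIsometryEquiv.refl ℂ _⟩
  have ho : Orthonormal ℂ fun n : ℤ => b (n + 1) :=
    b.orthonormal.comp _ (add_left_injective 1)
  let b' : HilbertBasis ℤ ℂ (lp (fun _ : ℤ => ℂ) 2) := HilbertBasis.mk ho (by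
    have hr : (Set.range fun n : ℤ => b (n + 1)) = Set.range b :=
      (add_right_surjective (1 : ℤ)).range_comp b
    rw [hr, b.dense_span])
  have hb' (n : ℤ) : b' n = b (n + 1) := by simp [b', HilbertBasis.coe_mk]
  let U := b.repr.trans b'.repr.symm
  have hU (n : ℤ) : U (b n) = b (n + 1) := by
    rw [← hb', LinearIsometryEquiv.trans_apply, b.repr_self, b'.repr_symm_single]
  have hV : Orthonormal ℂ fun n : ℕ => b n := b.orthonormal.comp _ Nat.cast_injective
  let V := hV.orthogonalFamily.linearIsometry
  have hVb (n : ℕ) : V (stdBasis n) = b n := by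
    rw [stdBasis, OrthogonalFamily.linearIsometry_apply_single]
    simp
  refine ⟨star (Unitary.linearIsometryEquiv.symm U), V.toContinuousLinearMap, ?_, ?_⟩
  · exact LinearIsometry.adjoint_comp_self V
  · refine clm_ext_stdBasis fun n => ?_
    rw [star_star]
    simp [hS, hVb, hU]

section Shift

open InnerProductSpace

variable {S : LTwo →L[ℂ] LTwo}

lemma star_shift_mul_shift (hS : ∀ n : ℕ, S (stdBasis n) = stdBasis (n + 1)) : star S * S = 1 := by
  obtain ⟨W, V, hV, hW⟩ := exists_unitary_dilation S hS
  have hSV : ∀ x, ‖S x‖ = ‖x‖ := fun x => by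
    have hn := (ContinuousLinearMap.norm_map_iff_adjoint_comp_self V).mpr hV
    rw [← hn, ← hn x, ← Unitary.norm_map (star W) (V x)]
    exact congrArg (‖· x‖) hW.symm
  exact (ContinuousLinearMap.norm_map_iff_adjoint_comp_self S).mp hSV

lemma star_shift_apply_zero (hS : ∀ n : ℕ, S (stdBasis n) = stdBasis (n + 1)) :
    star S (stdBasis 0) = 0 := by
  have h : innerSL ℂ (star S (stdBasis 0)) = 0 := by
    refine clm_ext_stdBasis fun n => ?_
    rw [innerSL_apply_apply, ContinuousLinearMap.star_eq_adjoint,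
      ContinuousLinearMap.adjoint_inner_left, hS]
    exact orthonormal_stdBasis.2 (Nat.succ_ne_zero n).symm
  rw [← norm_eq_zero, ← innerSL_apply_norm ℂ, h, norm_zero]

lemma one_sub_shift_mul_star (hS : ∀ n : ℕ, S (stdBasis n) = stdBasis (n + 1)) :
    1 - S * star S = rankOne ℂ (stdBasis 0) (stdBasis 0) := by
  refine clm_ext_stdBasis fun n => ?_
  cases n with
  | zero =>
    simp [star_shift_apply_zero hS, orthonormal_stdBasis.1 0]
  | succ n =>
    have h : star S (stdBasis (n + 1)) = stdBasis n := by
      rw [← hS]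
      exact congrArg (· (stdBasis n)) (star_shift_mul_shift hS)
    simp [h, hS, orthonormal_stdBasis.2 (Nat.succ_ne_zero n).symm]

lemma pow_shift_apply (hS : ∀ n : ℕ, S (stdBasis n) = stdBasis (n + 1)) (n : ℕ) :
    (S ^ n) (stdBasis 0) = stdBasis n := by
  induction n with
  | zero => simp
  | succ n ih => rw [pow_succ', mul_apply_eq_comp, ih, hS]

lemma isCompactOperator_rankOne {E : Type*} [NormedAddCommGroup E] [InnerProductSpace ℂ E]
    (x y : E) :
    IsCompactOperator (rankOne ℂ x y) := by
  rw [rankOne_def']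
  exact (isCompactOperator_of_locallyCompactSpace_rng
    (ContinuousLinearMap.toSpanSingleton ℂ x)).comp_clm _

/-- A compact operator on a Hilbert space lies in every closed subspace of operators containing the
rank one operators. -/
lemma IsCompactOperator.mem_of_rankOne_mem {E : Type*} [NormedAddCommGroup E]
    [InnerProductSpace ℂ E] [CompleteSpace E] {K : E →L[ℂ] E} (hK : IsCompactOperator K)
    (M : Submodule ℂ (E →L[ℂ] E)) (hM : IsClosed (M : Set (E →L[ℂ] E)))
    (h : ∀ x y, rankOne ℂ x y ∈ M) : K ∈ M := by
  rw [← SetLike.mem_coe, ← hM.closure_eq, Metric.mem_closure_iff]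
  intro ε hε
  have ht : TotallyBounded (K '' Metric.closedBall 0 1) :=
    (hK.isCompact_closure_image_closedBall (f := (K : E →ₗ[ℂ] E)) 1).totallyBounded.subset
      subset_closure
  obtain ⟨t, htf, hts⟩ := Metric.totallyBounded_iff.mp ht (ε / 2) (half_pos hε)
  let F := Submodule.span ℂ t
  have : FiniteDimensional ℂ F := FiniteDimensional.span_of_finite ℂ htf
  refine ⟨F.starProjection ∘L K, ?_, ?_⟩
  · rw [(stdOrthonormalBasis ℂ F).starProjection_eq_sum_rankOne, ContinuousLinearMap.finsetSum_comp]
    refine sum_mem fun i _ => ?_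
    rw [rankOne_comp]
    exact h _ _
  · rw [dist_eq_norm]
    refine lt_of_le_of_lt
      (ContinuousLinearMap.opNorm_le_of_unit_norm (half_pos hε).le fun x hx => ?_) (half_lt_self hε)
    have hx' := hts ⟨x, by simp [hx], rfl⟩
    simp only [Set.mem_iUnion, Metric.mem_ball] at hx'
    obtain ⟨y, hy, hxy⟩ := hx'
    refine le_trans ?_ hxy.le
    rw [dist_eq_norm]
    change ‖K x - F.starProjection (K x)‖ ≤ _
    rw [F.starProjection_minimal]
    exact ciInf_le ⟨0, by rintro _ ⟨z, rfl⟩; positivity⟩ (⟨y, Submodule.subset_span hy⟩ : F)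

/-- The Toeplitz quantization map: the compression of the functional calculus of the bilateral
shift. -/
lemma exists_toeplitzMap (hS : ∀ n : ℕ, S (stdBasis n) = stdBasis (n + 1)) :
    ∃ τ : C(Circle, ℂ) →L[ℂ] LTwo →L[ℂ] LTwo, τ 1 = 1 ∧
      (∀ f, τ (circleCoord * f) = star S * τ f) ∧ ∀ f, τ (f * star circleCoord) = τ f * S := by
  obtain ⟨W, V, hV, hW⟩ := exists_unitary_dilation S hS
  obtain ⟨Φ, hΦ, hΦW⟩ := exists_starAlgHom_circleCoord W
  have hW' : ContinuousLinearMap.adjoint V ∘L W.1 = star S ∘L ContinuousLinearMap.adjoint V := by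
    have := congrArg ContinuousLinearMap.adjoint hW
    simpa [ContinuousLinearMap.adjoint_comp, ContinuousLinearMap.star_eq_adjoint] using this
  refine ⟨⟨⟨⟨fun f => ContinuousLinearMap.adjoint V ∘L Φ f ∘L V, ?_⟩, ?_⟩, ?_⟩, ?_, ?_, ?_⟩
  · intro f g
    simp
  · intro c f
    simp
  · fun_prop
  · change ContinuousLinearMap.adjoint V ∘L Φ 1 ∘L V = 1
    rw [map_one, ContinuousLinearMap.one_def, ContinuousLinearMap.id_comp, hV]
  · intro f
    change ContinuousLinearMap.adjoint V ∘L Φ (circleCoord * f) ∘L V =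
      star S ∘L ContinuousLinearMap.adjoint V ∘L Φ f ∘L V
    rw [map_mul, hΦW, ContinuousLinearMap.mul_def, ContinuousLinearMap.comp_assoc,
      ← ContinuousLinearMap.comp_assoc, hW', ContinuousLinearMap.comp_assoc]
  · intro f
    change ContinuousLinearMap.adjoint V ∘L Φ (f * star circleCoord) ∘L V =
      (ContinuousLinearMap.adjoint V ∘L Φ f ∘L V) ∘L S
    rw [map_mul, map_star, hΦW, ContinuousLinearMap.mul_def, ContinuousLinearMap.comp_assoc,
      ← Unitary.coe_star, hW]
    rfl

variable (S) in
/-- The graph of the symbol map, as the C⋆-algebra generated by the pair `(S, z̄)`. -/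
abbrev symbolGraph : StarSubalgebra ℂ ((LTwo →L[ℂ] LTwo) × C(Circle, ℂ)) :=
  StarAlgebra.elemental ℂ (S, star circleCoord)

lemma shift_mem_symbolGraph : (S, star circleCoord) ∈ symbolGraph S :=
  StarAlgebra.elemental.self_mem ℂ _

lemma star_shift_mem_symbolGraph : (star S, circleCoord) ∈ symbolGraph S := by
  simpa [Prod.star_def] using StarAlgebra.elemental.star_self_mem ℂ (S, star circleCoord)

lemma isClosed_symbolGraph : IsClosed (symbolGraph S : Set ((LTwo →L[ℂ] LTwo) × C(Circle, ℂ))) :=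
  StarAlgebra.elemental.isClosed ℂ _

lemma toeplitzMap_mem_symbolGraph {τ : C(Circle, ℂ) →L[ℂ] LTwo →L[ℂ] LTwo} (h1 : τ 1 = 1)
    (hz : ∀ f, τ (circleCoord * f) = star S * τ f) (hzs : ∀ f, τ (f * star circleCoord) = τ f * S)
    (f : C(Circle, ℂ)) : (τ f, f) ∈ symbolGraph S := by
  let M : Submodule ℂ C(Circle, ℂ) :=
    (symbolGraph S).toSubalgebra.toSubmodule.comap ((τ : C(Circle, ℂ) →ₗ[ℂ] _).prod LinearMap.id)
  refine mem_of_circleCoord_pow_mem M ?_ (fun m n => ?_) f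
  · exact isClosed_symbolGraph.preimage (τ.continuous.prodMk continuous_id)
  · have hn : ∀ n : ℕ, τ (star circleCoord ^ n) = S ^ n := fun n => by
      induction n with
      | zero => simpa using h1
      | succ n ih => rw [pow_succ, hzs, ih, pow_succ]
    have hmn : τ (circleCoord ^ m * star circleCoord ^ n) = star S ^ m * S ^ n := by
      induction m with
      | zero => simpa using hn n
      | succ m ih => rw [pow_succ', mul_assoc, hz, ih, pow_succ', mul_assoc]
    change (τ (circleCoord ^ m * star circleCoord ^ n), _) ∈ symbolGraph S
    rw [hmn]
    exact mul_mem (pow_mem star_shift_mem_symbolGraph m) (pow_mem shift_mem_symbolGraph n)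

lemma isCompactOperator_sub_toeplitzMap (hS : ∀ n : ℕ, S (stdBasis n) = stdBasis (n + 1))
    {τ : C(Circle, ℂ) →L[ℂ] LTwo →L[ℂ] LTwo} (h1 : τ 1 = 1)
    (hz : ∀ f, τ (circleCoord * f) = star S * τ f)
    {p : (LTwo →L[ℂ] LTwo) × C(Circle, ℂ)} (hp : p ∈ symbolGraph S) :
    IsCompactOperator (p.1 - τ p.2) := by
  let D : ((LTwo →L[ℂ] LTwo) × C(Circle, ℂ)) →L[ℂ] LTwo →L[ℂ] LTwo :=
    ContinuousLinearMap.fst ℂ _ _ - τ ∘L ContinuousLinearMap.snd ℂ _ _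
  suffices ∀ q, IsCompactOperator (D q) → IsCompactOperator (D (p * q)) by
    simpa [D] using this 1 (by simpa [D, h1] using isCompactOperator_zero)
  induction hp using StarAlgebra.elemental.induction_on with
  | self =>
    intro q hq
    have hq2 : q.2 = circleCoord * (star circleCoord * q.2) := by
      rw [← mul_assoc, circleCoord_mul_star, one_mul]
    have : D ((S, star circleCoord) * q) = S * D q -
        rankOne ℂ (stdBasis 0) (stdBasis 0) * τ (star circleCoord * q.2) := by
      have : τ q.2 = star S * τ (star circleCoord * q.2) := by rw [← hz, ← hq2]
      simp only [D, sub_apply, ContinuousLinearMap.comp_apply,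
        ContinuousLinearMap.coe_fst', ContinuousLinearMap.coe_snd', Prod.fst_mul, Prod.snd_mul,
        ← one_sub_shift_mul_star hS, this]
      noncomm_ring
    rw [this]
    exact (IsCompactOperator.clm_comp hq S).sub
      (IsCompactOperator.comp_clm (isCompactOperator_rankOne (stdBasis 0) (stdBasis 0)) _)
  | star_self =>
    intro q hq
    have : D (star (S, star circleCoord) * q) = star S * D q := by
      simp [D, Prod.star_def, hz, mul_sub]
    rw [this]
    exact IsCompactOperator.clm_comp hq (star S)
  | algebraMap r =>
    intro q hq
    rw [← Algebra.smul_def, map_smul]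
    exact hq.smul r
  | add u _ v _ hu hv =>
    intro q hq
    rw [add_mul, map_add]
    exact (hu q hq).add (hv q hq)
  | mul u _ v _ hu hv =>
    intro q hq
    rw [mul_assoc]
    exact hu _ (hv q hq)
  | closure s _ hs v hv =>
    intro q hq
    refine closure_minimal (t := {v | IsCompactOperator (D (v * q))}) (fun u hu => hs u hu q hq)
      ?_ hv
    exact isClosed_setOfPred_isCompactOperator.preimage
      (D.continuous.comp (continuous_id.mul continuous_const))

lemma mem_of_stdBasis_mem {σ : ℂ →+* ℂ} [RingHomSurjective σ] {F : Type*}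
    [NormedAddCommGroup F] [NormedSpace ℂ F] (L : LTwo →SL[σ] F) (M : Submodule ℂ F)
    (hM : IsClosed (M : Set F))
    (h : ∀ n, L (stdBasis n) ∈ M) (x : LTwo) : L x ∈ M := by
  have hle : (Submodule.span ℂ (Set.range stdBasis)).topologicalClosure ≤ M.comap L.toLinearMap :=
    Submodule.topologicalClosure_minimal _
      (Submodule.span_le.mpr (Set.range_subset_iff.mpr h)) (hM.preimage L.continuous)
  exact hle (dense_span_stdBasis ▸ Submodule.mem_top)

lemma rankOne_mem_of_stdBasis (M : Submodule ℂ (LTwo →L[ℂ] LTwo))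
    (hM : IsClosed (M : Set (LTwo →L[ℂ] LTwo)))
    (hmn : ∀ m n, rankOne ℂ (stdBasis m) (stdBasis n) ∈ M) (x y : LTwo) : rankOne ℂ x y ∈ M := by
  have hm (m : ℕ) : rankOne ℂ (stdBasis m) y ∈ M :=
    mem_of_stdBasis_mem (rankOne ℂ (stdBasis m)) M hM (hmn m) y
  let L : LTwo →L[ℂ] LTwo →L[ℂ] LTwo :=
    LinearMap.mkContinuous ⟨⟨fun x => rankOne ℂ x y, fun a b => by simp⟩, fun c a => by simp⟩ ‖y‖
      fun x => by simp [mul_comm]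
  exact mem_of_stdBasis_mem L M hM hm x

lemma isCompactOperator_mem_symbolGraph (hS : ∀ n : ℕ, S (stdBasis n) = stdBasis (n + 1))
    {K : LTwo →L[ℂ] LTwo} (hK : IsCompactOperator K) : (K, 0) ∈ symbolGraph S := by
  let M : Submodule ℂ (LTwo →L[ℂ] LTwo) :=
    (symbolGraph S).toSubalgebra.toSubmodule.comap (LinearMap.inl ℂ _ _)
  have hM : IsClosed (M : Set (LTwo →L[ℂ] LTwo)) :=
    isClosed_symbolGraph.preimage (continuous_id.prodMk continuous_const)
  have h0 : (rankOne ℂ (stdBasis 0) (stdBasis 0), (0 : C(Circle, ℂ))) ∈ symbolGraph S := by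
    have := sub_mem (one_mem (symbolGraph S))
      (mul_mem (shift_mem_symbolGraph (S := S)) star_shift_mem_symbolGraph)
    rwa [Prod.mk_mul_mk, star_circleCoord_mul, ← Prod.mk_one_one, Prod.mk_sub_mk, sub_self,
      one_sub_shift_mul_star hS] at this
  have hmn (m n : ℕ) : rankOne ℂ (stdBasis m) (stdBasis n) ∈ M := by
    have := mul_mem (mul_mem (pow_mem (shift_mem_symbolGraph (S := S)) m) h0)
      (pow_mem star_shift_mem_symbolGraph n)
    rw [Prod.pow_mk, Prod.pow_mk, Prod.mk_mul_mk, Prod.mk_mul_mk, mul_zero, zero_mul] at this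
    have e : S ^ m * rankOne ℂ (stdBasis 0) (stdBasis 0) * star S ^ n =
        rankOne ℂ (stdBasis m) (stdBasis n) := by
      rw [ContinuousLinearMap.mul_def, ContinuousLinearMap.mul_def, comp_rankOne, rankOne_comp,
        ← star_pow, ContinuousLinearMap.star_eq_adjoint, ContinuousLinearMap.adjoint_adjoint,
        pow_shift_apply hS, pow_shift_apply hS]
    rwa [e] at this
  exact hK.mem_of_rankOne_mem M hM (rankOne_mem_of_stdBasis M hM hmn)

/-- The partial sums of the formal eigenvector `∑ tᵏ eₖ` of the backward shift. -/
def shiftVec (t : Circle) (N : ℕ) : LTwo := ∑ k ∈ Finset.range N, (t : ℂ) ^ k • stdBasis k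

lemma norm_shiftVec_sq (t : Circle) (N : ℕ) : ‖shiftVec t N‖ ^ 2 = N := by
  have h := orthonormal_stdBasis.inner_sum (fun k => (t : ℂ) ^ k) (fun k => (t : ℂ) ^ k)
    (Finset.range N)
  have ht (k : ℕ) : (starRingEnd ℂ) ((t : ℂ) ^ k) * (t : ℂ) ^ k = 1 := by
    rw [← Complex.normSq_eq_conj_mul_self, Complex.normSq_eq_norm_sq, norm_pow, Circle.norm_coe]
    simp
  rw [← shiftVec, inner_self_eq_norm_sq_to_K] at h
  simp only [ht, Finset.sum_const, Finset.card_range, nsmul_eq_mul, mul_one] at h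
  exact Complex.ofReal_injective (by simpa using h)

lemma shift_shiftVec (hS : ∀ n : ℕ, S (stdBasis n) = stdBasis (n + 1)) (t : Circle) (N : ℕ) :
    (t : ℂ) • S (shiftVec t N) = shiftVec t N + (t : ℂ) ^ N • stdBasis N - stdBasis 0 := by
  have h1 := Finset.sum_range_succ (fun k => (t : ℂ) ^ k • stdBasis k) N
  rw [Finset.sum_range_succ'] at h1
  rw [shiftVec, ← h1, map_sum, Finset.smul_sum]
  simp [hS, smul_smul, pow_succ']

lemma norm_shift_shiftVec_sub_le (hS : ∀ n : ℕ, S (stdBasis n) = stdBasis (n + 1)) (t : Circle)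
    (N : ℕ) : ‖(t : ℂ) • S (shiftVec t N) - shiftVec t N‖ ≤ 2 := by
  rw [shift_shiftVec hS, add_sub_assoc, add_sub_cancel_left]
  refine (norm_sub_le _ _).trans ?_
  rw [norm_smul, orthonormal_stdBasis.1, orthonormal_stdBasis.1, norm_pow, Circle.norm_coe]
  norm_num

lemma exists_norm_sub_shiftVec_le (hS : ∀ n : ℕ, S (stdBasis n) = stdBasis (n + 1)) (t : Circle)
    {p : (LTwo →L[ℂ] LTwo) × C(Circle, ℂ)}
    (hp : p ∈ StarAlgebra.adjoin ℂ {(S, star circleCoord)}) :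
    ∃ C : ℝ, ∀ N, ‖p.1 (shiftVec t N) - p.2 t • shiftVec t N‖ ≤ C := by
  have hw : ∀ N, ‖S (shiftVec t N) - star circleCoord t • shiftVec t N‖ ≤ 2 := fun N => by
    have h := norm_shift_shiftVec_sub_le hS t N
    have ht : (starRingEnd ℂ) (t : ℂ) * t = 1 := by
      rw [← Complex.normSq_eq_conj_mul_self]
      simp
    have e : S (shiftVec t N) - star circleCoord t • shiftVec t N =
        (starRingEnd ℂ) (t : ℂ) • ((t : ℂ) • S (shiftVec t N) - shiftVec t N) := by
      rw [smul_sub, smul_smul, ht, one_smul]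
      rfl
    rwa [e, norm_smul, RCLike.norm_conj, Circle.norm_coe, one_mul]
  rw [← StarSubalgebra.mem_toSubalgebra, StarAlgebra.adjoin_toSubalgebra] at hp
  induction hp using Algebra.adjoin_induction with
  | mem x hx =>
    rw [Set.star_singleton, Set.singleton_union, Set.mem_insert_iff, Set.mem_singleton_iff] at hx
    obtain rfl | rfl := hx
    · exact ⟨2, hw⟩
    · refine ⟨‖star S‖ * 2, fun N => ?_⟩
      have e : star S (shiftVec t N) - (t : ℂ) • shiftVec t N =
          -(star S ((t : ℂ) • S (shiftVec t N) - shiftVec t N)) := by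
        have : star S (S (shiftVec t N)) = shiftVec t N :=
          congrArg (· (shiftVec t N)) (star_shift_mul_shift hS)
        rw [map_sub, map_smul, this, neg_sub]
      change ‖star S (shiftVec t N) - star (star (t : ℂ)) • shiftVec t N‖ ≤ _
      rw [star_star, e, norm_neg]
      exact (star S).le_opNorm_of_le (norm_shift_shiftVec_sub_le hS t N)
  | algebraMap r =>
    refine ⟨0, fun N => le_of_eq ?_⟩
    rw [norm_eq_zero, sub_eq_zero]
    simp [Algebra.algebraMap_eq_smul_one]
  | add x y _ _ hx hy =>
    obtain ⟨C, hC⟩ := hx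
    obtain ⟨D, hD⟩ := hy
    refine ⟨C + D, fun N => (le_of_eq ?_).trans ((norm_add_le _ _).trans
      (add_le_add (hC N) (hD N)))⟩
    congr 1
    simp only [Prod.fst_add, Prod.snd_add, add_apply, ContinuousMap.add_apply]
    module
  | mul x y _ _ hx hy =>
    obtain ⟨C, hC⟩ := hx
    obtain ⟨D, hD⟩ := hy
    refine ⟨‖x.1‖ * D + ‖y.2 t‖ * C, fun N => (le_of_eq ?_).trans ((norm_add_le _ _).trans
      (add_le_add (x.1.le_opNorm_of_le (hD N))
        ((norm_smul_le (y.2 t) _).trans (mul_le_mul_of_nonneg_left (hC N) (norm_nonneg _)))))⟩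
    congr 1
    simp only [Prod.fst_mul, Prod.snd_mul, mul_apply_eq_comp, ContinuousMap.mul_apply, map_sub,
      map_smul]
    module

lemma norm_snd_le_norm_fst (hS : ∀ n : ℕ, S (stdBasis n) = stdBasis (n + 1))
    {p : (LTwo →L[ℂ] LTwo) × C(Circle, ℂ)} (hp : p ∈ symbolGraph S) : ‖p.2‖ ≤ ‖p.1‖ := by
  refine closure_minimal (t := {p : (LTwo →L[ℂ] LTwo) × C(Circle, ℂ) | ‖p.2‖ ≤ ‖p.1‖})
    (fun q hq => ?_) (isClosed_le continuous_snd.norm continuous_fst.norm) hp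
  refine (ContinuousMap.norm_le _ (norm_nonneg _)).mpr fun t => ?_
  obtain ⟨C, hC⟩ := exists_norm_sub_shiftVec_le hS t hq
  by_contra! hlt
  have key (N : ℕ) : ‖shiftVec t N‖ * (‖q.2 t‖ - ‖q.1‖) ≤ C := by
    have h1 := norm_sub_norm_le (q.2 t • shiftVec t N) (q.1 (shiftVec t N))
    rw [norm_sub_rev, norm_smul] at h1
    have h2 := q.1.le_opNorm (shiftVec t N)
    linarith [hC N]
  obtain ⟨N, hN⟩ := exists_nat_gt ((C / (‖q.2 t‖ - ‖q.1‖)) ^ 2)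
  rw [← norm_shiftVec_sq t N] at hN
  refine absurd (key N) (not_le.mpr ?_)
  rw [← div_lt_iff₀ (sub_pos.mpr hlt)]
  exact lt_of_pow_lt_pow_left₀ 2 (norm_nonneg _) hN

variable (S) in
/-- The first projection of the graph of the symbol map. -/
def symbolGraphFst : symbolGraph S →⋆ₐ[ℂ] LTwo →L[ℂ] LTwo :=
  (StarAlgHom.fst ℂ (LTwo →L[ℂ] LTwo) C(Circle, ℂ)).comp (symbolGraph S).subtype

lemma isometry_symbolGraphFst (hS : ∀ n : ℕ, S (stdBasis n) = stdBasis (n + 1)) :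
    Isometry (symbolGraphFst S) := by
  refine AddMonoidHomClass.isometry_of_norm _ fun p => ?_
  exact (max_eq_left (norm_snd_le_norm_fst hS p.2)).symm

lemma fst_mem_elemental {p : (LTwo →L[ℂ] LTwo) × C(Circle, ℂ)} (hp : p ∈ symbolGraph S) :
    p.1 ∈ StarAlgebra.elemental ℂ S := by
  have hcl : IsClosed ((StarAlgebra.elemental ℂ S).comap
      (StarAlgHom.fst ℂ (LTwo →L[ℂ] LTwo) C(Circle, ℂ)) :
        Set ((LTwo →L[ℂ] LTwo) × C(Circle, ℂ))) :=
    (StarAlgebra.elemental.isClosed ℂ S).preimage continuous_fst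
  exact StarAlgebra.elemental.le_of_mem hcl (StarAlgebra.elemental.self_mem ℂ S) hp

lemma elemental_le_range (hS : ∀ n : ℕ, S (stdBasis n) = stdBasis (n + 1)) :
    StarAlgebra.elemental ℂ S ≤ (symbolGraphFst S).range := by
  have hcl : IsClosed ((symbolGraphFst S).range : Set (LTwo →L[ℂ] LTwo)) := by
    exact (isometry_symbolGraphFst hS).isClosedEmbedding.isClosed_range
  exact StarAlgebra.elemental.le_of_mem hcl ⟨⟨_, shift_mem_symbolGraph⟩, rfl⟩

/-- The symbol map on the Toeplitz algebra. -/
def symbolMap (hS : ∀ n : ℕ, S (stdBasis n) = stdBasis (n + 1)) :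
    StarAlgebra.elemental ℂ S →⋆ₐ[ℂ] C(Circle, ℂ) :=
  ((StarAlgHom.snd ℂ (LTwo →L[ℂ] LTwo) C(Circle, ℂ)).comp (symbolGraph S).subtype).comp
    ((StarAlgEquiv.ofInjective (symbolGraphFst S)
      (isometry_symbolGraphFst hS).injective).symm.toStarAlgHom.comp
        (StarSubalgebra.inclusion (elemental_le_range hS)))

lemma symbolMap_eq (hS : ∀ n : ℕ, S (stdBasis n) = stdBasis (n + 1))
    {x : StarAlgebra.elemental ℂ S} {f : C(Circle, ℂ)} (h : (x.1, f) ∈ symbolGraph S) :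
    symbolMap hS x = f := by
  have : (StarAlgEquiv.ofInjective (symbolGraphFst S) (isometry_symbolGraphFst hS).injective).symm
      (StarSubalgebra.inclusion (elemental_le_range hS) x) = ⟨(x.1, f), h⟩ :=
    (StarAlgEquiv.symm_apply_eq _).mpr rfl
  exact congrArg (fun p : symbolGraph S => p.1.2) this

lemma mem_symbolGraph_symbolMap (hS : ∀ n : ℕ, S (stdBasis n) = stdBasis (n + 1))
    (x : StarAlgebra.elemental ℂ S) : (x.1, symbolMap hS x) ∈ symbolGraph S := by
  obtain ⟨⟨⟨T, f⟩, hp⟩, hx⟩ := elemental_le_range hS x.2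
  obtain rfl : T = x.1 := hx
  rwa [symbolMap_eq hS hp]

end Shift

set_option synthInstance.maxHeartbeats 1000000 in
set_option maxHeartbeats 1000000 in
/-- The compact operators are contained in the Toeplitz algebra `C*(S)`, and there is a
surjective star-algebra homomorphism `β : C*(S) → C(𝕋)` with kernel exactly the compact
operators, sending `S*` to the coordinate function `z`; in particular
`C*(S)/K(ℓ²(ℤ₊)) ≅ C(𝕋)`. -/
theorem stmt9
    (S : LTwo →L[ℂ] LTwo)
    (hS : ∀ n : ℕ, S (stdBasis n) = stdBasis (n + 1)) :
    (∀ k : LTwo →L[ℂ] LTwo, IsCompactOperator k → k ∈ StarAlgebra.elemental ℂ S) ∧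
    ∃ β : StarAlgebra.elemental ℂ S →⋆ₐ[ℂ] C(Circle, ℂ),
      Function.Surjective β ∧
      (∀ x : StarAlgebra.elemental ℂ S,
        β x = 0 ↔ IsCompactOperator ((x : LTwo →L[ℂ] LTwo))) ∧
      ∀ h : star S ∈ StarAlgebra.elemental ℂ S,
        β ⟨star S, h⟩ = ⟨fun t : Circle => (t : ℂ), continuous_subtype_val⟩ := by
  obtain ⟨τ, h1, hz, hzs⟩ := exists_toeplitzMap hS
  refine ⟨fun k hk => fst_mem_elemental (isCompactOperator_mem_symbolGraph hS hk), symbolMap hS,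
    fun f => ?_, fun x => ⟨fun hx => ?_, fun hx => ?_⟩, fun h => ?_⟩
  · have hf := toeplitzMap_mem_symbolGraph h1 hz hzs f
    exact ⟨⟨τ f, fst_mem_elemental hf⟩, symbolMap_eq hS hf⟩
  · have := isCompactOperator_sub_toeplitzMap hS h1 hz (mem_symbolGraph_symbolMap hS x)
    simpa [hx] using this
  · exact symbolMap_eq hS (isCompactOperator_mem_symbolGraph hS hx)
  · exact symbolMap_eq hS star_shift_mem_symbolGraph
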